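/- arXiv:2302.00964 — 2 statements merged into one kernel-verified Lean document; each statement's English description precedes it below -/
import Mathlib

section
/- For every positive integer k and every integer n ≥ 0, the following chain of equalities holds: q_{2k}(8n + 2k) = δ_{2k}(n) = Σ_{(a,b) ∈ ℕ², a+2b=n} r_k(a)·δ_k(b) = Σ_{(a,b) ∈ ℕ², a+2b=n} r_k(a)·q_k(8b + k). -/
/-- `deltaRep k c n` is the number of `k`-tuples `(x₁, …, x_k)` of nonnegative integers
with `n = Σᵢ cᵢ · xᵢ(xᵢ+1)/2`. -/
noncomputable def deltaRep (k : ℕ) (c : Fin k → ℕ) (n : ℕ) : ℕ :=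
  Set.ncard {x : Fin k → ℕ | n = ∑ i, c i * (x i * (x i + 1) / 2)}

/-- `rRep v b n` is the number of `v`-tuples `(y₁, …, y_v)` of integers with
`n = Σᵢ bᵢ · yᵢ²`. -/
noncomputable def rRep (v : ℕ) (b : Fin v → ℕ) (n : ℕ) : ℕ :=
  Set.ncard {y : Fin v → ℤ | (n : ℤ) = ∑ i, (b i : ℤ) * y i ^ 2}

/-- `qRep k c n` is the number of `k`-tuples `(y₁, …, y_k)` of positive odd integers with
`n = Σᵢ cᵢ · yᵢ²`. -/
noncomputable def qRep (k : ℕ) (c : Fin k → ℕ) (n : ℕ) : ℕ :=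
  Set.ncard {y : Fin k → ℕ | (∀ i, 0 < y i ∧ Odd (y i)) ∧ n = ∑ i, c i * y i ^ 2}

/-- `NstRep v k b c n` is the number of pairs of tuples `((y₁, …, y_v), (z₁, …, z_k))`
with the `yᵢ` integers and the `z_j` nonnegative integers such that
`n = Σᵢ bᵢ·yᵢ² + Σⱼ cⱼ·zⱼ(zⱼ+1)/2`. -/
noncomputable def NstRep (v k : ℕ) (b : Fin v → ℕ) (c : Fin k → ℕ) (n : ℕ) : ℕ :=
  Set.ncard {p : (Fin v → ℤ) × (Fin k → ℕ) |
    (n : ℤ) = ∑ i, (b i : ℤ) * p.1 i ^ 2 +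
      ∑ j, (c j : ℤ) * ((p.2 j * (p.2 j + 1) / 2 : ℕ) : ℤ)}

/-- The finite set of pairs `(a, b)` of nonnegative integers with `a + 2b = n`. -/
def convPairs (n : ℕ) : Finset (ℕ × ℕ) :=
  (Finset.range (n + 1) ×ˢ Finset.range (n + 1)).filter fun p => p.1 + 2 * p.2 = n

/-- Doubling a triangular number. -/
theorem two_mul_triangular (x : ℕ) : 2 * (x * (x + 1) / 2) = x * (x + 1) :=
  Nat.mul_div_cancel' (Nat.even_mul_succ_self x).two_dvd

/-- A bijection carrying `a² + 2 · b(b+1)/2` to the sum of two triangular numbers. -/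
def squareTriangularEquiv : ℤ × ℕ ≃ ℕ × ℕ where
  toFun p :=
    if p.1.natAbs ≤ p.2 then ((p.2 + p.1).toNat, (p.2 - p.1).toNat)
    else if 0 < p.1 then ((p.1 + p.2).toNat, (p.1 - p.2 - 1).toNat)
    else ((-p.1 - p.2 - 1).toNat, (-p.1 + p.2).toNat)
  invFun q :=
    if (q.1 + q.2) % 2 = 0 then (((q.1 : ℤ) - q.2) / 2, (q.1 + q.2) / 2)
    else if q.2 < q.1 then (((q.1 : ℤ) + q.2 + 1) / 2, (q.1 - q.2 - 1) / 2)
    else (-(((q.1 : ℤ) + q.2 + 1) / 2), (q.2 - q.1 - 1) / 2)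
  left_inv := by
    rintro ⟨a, b⟩
    dsimp only
    split_ifs <;> simp only [Prod.mk.injEq] at * <;> omega
  right_inv := by
    rintro ⟨x, y⟩
    dsimp only
    split_ifs <;> simp only [Prod.mk.injEq] at * <;> omega

theorem squareTriangularEquiv_triangular_add (p : ℤ × ℕ) :
    (((squareTriangularEquiv p).1 * ((squareTriangularEquiv p).1 + 1) / 2 +
      (squareTriangularEquiv p).2 * ((squareTriangularEquiv p).2 + 1) / 2 : ℕ) : ℤ) =
      p.1 ^ 2 + 2 * ((p.2 * (p.2 + 1) / 2 : ℕ) : ℤ) := by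
  have h (x : ℕ) : 2 * ((x * (x + 1) / 2 : ℕ) : ℤ) = x * (x + 1) := by
    exact_mod_cast two_mul_triangular x
  refine mul_left_cancel₀ (two_ne_zero (α := ℤ)) ?_
  rw [Nat.cast_add, mul_add, h, h, h]
  obtain ⟨a, b⟩ := p
  simp only [squareTriangularEquiv, Equiv.coe_fn_mk]
  split_ifs with h₀ h₁
  · have hx : ((b + a).toNat : ℤ) = b + a := Int.toNat_of_nonneg (by omega)
    have hy : ((b - a).toNat : ℤ) = b - a := Int.toNat_of_nonneg (by omega)
    simp only [hx, hy]
    ring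
  · have hx : ((a + b).toNat : ℤ) = a + b := Int.toNat_of_nonneg (by omega)
    have hy : ((a - b - 1).toNat : ℤ) = a - b - 1 := Int.toNat_of_nonneg (by omega)
    simp only [hx, hy]
    ring
  · have hx : ((-a - b - 1).toNat : ℤ) = -a - b - 1 := Int.toNat_of_nonneg (by omega)
    have hy : ((-a + b).toNat : ℤ) = -a + b := Int.toNat_of_nonneg (by omega)
    simp only [hx, hy]
    ring

theorem qRep_eq_deltaRep (k n : ℕ) :
    qRep k (fun _ => 1) (8 * n + k) = deltaRep k (fun _ => 1) n := by
  have hinj : Function.Injective fun (x : Fin k → ℕ) i => 2 * x i + 1 := fun x y h => by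
    ext i
    have := congrFun h i
    simp only at this
    omega
  refine Eq.trans ?_ (Set.ncard_image_of_injective _ hinj)
  have key (x : Fin k → ℕ) :
      ∑ i, (2 * x i + 1) ^ 2 = 8 * ∑ i, x i * (x i + 1) / 2 + k := by
    have h (i : Fin k) : (2 * x i + 1) ^ 2 = 8 * (x i * (x i + 1) / 2) + 1 := by
      linarith [two_mul_triangular (x i)]
    simp [h, Finset.sum_add_distrib, Finset.mul_sum]
  refine congrArg Set.ncard (Set.ext fun y => ?_)
  simp only [one_mul, Set.mem_ofPred_eq, Set.mem_image]
  constructor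
  · rintro ⟨hy, hn⟩
    choose x hx using fun i => (hy i).2
    obtain rfl : y = fun i => 2 * x i + 1 := funext hx
    refine ⟨x, ?_, rfl⟩
    have := hn.trans (key x)
    omega
  · rintro ⟨x, hn, rfl⟩
    refine ⟨fun i => ⟨Nat.succ_pos _, odd_two_mul_add_one _⟩, ?_⟩
    rw [key, hn]

/-- The bijection between `2k`-tuples of naturals and pairs of an integer `k`-tuple and a natural
`k`-tuple induced by `squareTriangularEquiv`. -/
def squareTriangularTupleEquiv (k : ℕ) : (Fin k → ℤ) × (Fin k → ℕ) ≃ (Fin (2 * k) → ℕ) :=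
  (Equiv.arrowProdEquivProdArrow (Fin k) (fun _ => ℤ) (fun _ => ℕ)).symm.trans <|
  (Equiv.arrowCongr (Equiv.refl _) squareTriangularEquiv).trans <|
  (Equiv.arrowProdEquivProdArrow (Fin k) (fun _ => ℕ) (fun _ => ℕ)).trans <|
  (Equiv.sumArrowEquivProdArrow (Fin k) (Fin k) ℕ).symm.trans <|
  Equiv.arrowCongr (finSumFinEquiv.trans (finCongr (two_mul k).symm)) (Equiv.refl ℕ)

theorem sum_triangular_squareTriangularTupleEquiv (k : ℕ) (p : (Fin k → ℤ) × (Fin k → ℕ)) :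
    ((∑ i, squareTriangularTupleEquiv k p i *
      (squareTriangularTupleEquiv k p i + 1) / 2 : ℕ) : ℤ) =
      ∑ i, p.1 i ^ 2 + 2 * ((∑ i, p.2 i * (p.2 i + 1) / 2 : ℕ) : ℤ) := by
  rw [← (finSumFinEquiv.trans (finCongr (two_mul k).symm)).sum_comp, Fintype.sum_sum_type,
    ← Finset.sum_add_distrib, Nat.cast_sum, Nat.cast_sum, Finset.mul_sum, ← Finset.sum_add_distrib]
  refine Finset.sum_congr rfl fun i _ => ?_
  rw [← squareTriangularEquiv_triangular_add (p.1 i, p.2 i)]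
  simp [-finSumFinEquiv_apply_left, -finSumFinEquiv_apply_right,
    squareTriangularTupleEquiv, Equiv.arrowProdEquivProdArrow, Equiv.sumArrowEquivProdArrow,
    Equiv.arrowCongr]

theorem finite_setOf_sum_sq_eq (k n : ℕ) :
    {y : Fin k → ℤ | (n : ℤ) = ∑ i, y i ^ 2}.Finite := by
  refine (Set.Finite.pi' fun _ : Fin k => Set.finite_Icc (-n : ℤ) n).subset fun y hy i => ?_
  have h : y i ^ 2 ≤ n := (Finset.single_le_sum (f := fun i => y i ^ 2)
    (fun j _ => sq_nonneg _) (Finset.mem_univ i)).trans_eq hy.symm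
  constructor <;> nlinarith

theorem finite_setOf_sum_triangular_eq (k n : ℕ) :
    {x : Fin k → ℕ | n = ∑ i, x i * (x i + 1) / 2}.Finite := by
  refine (Set.Finite.pi' fun _ : Fin k => Set.finite_Iic n).subset fun x hx i => ?_
  have h : x i * (x i + 1) / 2 ≤ n := (Finset.single_le_sum (f := fun i => x i * (x i + 1) / 2)
    (fun j _ => Nat.zero_le _) (Finset.mem_univ i)).trans_eq hx.symm
  have := two_mul_triangular (x i)
  rw [Set.mem_Iic]
  nlinarith

theorem mem_convPairs {n : ℕ} {p : ℕ × ℕ} : p ∈ convPairs n ↔ p.1 + 2 * p.2 = n := by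
  simp only [convPairs, Finset.mem_filter, Finset.mem_product, Finset.mem_range]
  omega

theorem deltaRep_two_mul_eq_sum (k n : ℕ) :
    deltaRep (2 * k) (fun _ => 1) n =
      ∑ p ∈ convPairs n, rRep k (fun _ => 1) p.1 * deltaRep k (fun _ => 1) p.2 := by
  simp only [deltaRep, rRep, one_mul, Nat.cast_one, ← Set.ncard_prod]
  rw [← finsum_mem_coe_finset, ← Set.Finite.ncard_biUnion (Finset.finite_toSet _)
    (fun p _ => (finite_setOf_sum_sq_eq k p.1).prod (finite_setOf_sum_triangular_eq k p.2)),
    ← Set.ncard_image_of_injective _ (squareTriangularTupleEquiv k).symm.injective]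
  · congr 1
    ext q
    rw [Equiv.image_symm_eq_preimage]
    simp only [Set.mem_preimage, Set.mem_ofPred_eq, Set.mem_iUnion, Set.mem_prod, Finset.mem_coe,
      mem_convPairs]
    have key := sum_triangular_squareTriangularTupleEquiv k q
    constructor
    · intro h
      have h₀ : 0 ≤ ∑ i, q.1 i ^ 2 := Finset.sum_nonneg fun i _ => sq_nonneg _
      refine ⟨((∑ i, q.1 i ^ 2).toNat, ∑ i, q.2 i * (q.2 i + 1) / 2), ?_, ?_, rfl⟩
      · dsimp only
        omega
      · exact Int.toNat_of_nonneg h₀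
    · rintro ⟨p, hp, h₁, h₂⟩
      omega
  · intro p _ p' _ hne
    refine Set.disjoint_left.2 fun q hq hq' => hne ?_
    simp only [Set.mem_prod, Set.mem_ofPred_eq] at hq hq'
    ext <;> omega

theorem delta_two_k_relations (k : ℕ) (hk : 0 < k) (n : ℕ) :
    qRep (2 * k) (fun _ => 1) (8 * n + 2 * k) = deltaRep (2 * k) (fun _ => 1) n ∧
    deltaRep (2 * k) (fun _ => 1) n =
      ∑ p ∈ convPairs n, rRep k (fun _ => 1) p.1 * deltaRep k (fun _ => 1) p.2 ∧
    (∑ p ∈ convPairs n, rRep k (fun _ => 1) p.1 * deltaRep k (fun _ => 1) p.2) =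
      ∑ p ∈ convPairs n, rRep k (fun _ => 1) p.1 * qRep k (fun _ => 1) (8 * p.2 + k) := by
  exact ⟨qRep_eq_deltaRep _ _, deltaRep_two_mul_eq_sum k n,
    Finset.sum_congr rfl fun p _ => by rw [qRep_eq_deltaRep]⟩
end

section
/- For every integer n ≥ 0, δ₈(n) = Σ_{(a,b) ∈ ℕ², a+2b=n} r₄(a)·σ(2b + 1). -/
/-- The `x`-th triangular number. -/
def tri (x : ℕ) : ℕ := x * (x + 1) / 2

lemma two_mul_tri (x : ℕ) : 2 * tri x = x * (x + 1) :=
  Nat.two_mul_div_two_of_even (Nat.even_mul_succ_self x)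

lemma le_tri (x : ℕ) : x ≤ tri x := by
  have := two_mul_tri x
  nlinarith

lemma two_mul_tri_cast (x : ℕ) : 2 * (tri x : ℤ) = x * (x + 1) := mod_cast two_mul_tri x

/-- The value-preserving bijection behind `ψ(q)² = φ(q) ψ(q²)`: pairs `(x, y)` with
`T_x + T_y = n` correspond to pairs `(m, z)` with `m² + 2 T_z = n`. -/
def triPairEquiv : ℕ × ℕ ≃ ℤ × ℕ where
  toFun p :=
    if (p.1 + p.2) % 2 = 0 then (((p.1 : ℤ) - p.2) / 2, (p.1 + p.2) / 2)
    else if p.2 < p.1 then (((p.1 : ℤ) + p.2 + 1) / 2, (p.1 - p.2 - 1) / 2)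
    else (-(((p.1 : ℤ) + p.2 + 1) / 2), (p.2 - p.1 - 1) / 2)
  invFun q :=
    if |q.1| ≤ q.2 then ((q.2 + q.1).toNat, (q.2 - q.1).toNat)
    else if 0 < q.1 then ((q.1 + q.2).toNat, (q.1 - q.2 - 1).toNat)
    else ((-q.1 - q.2 - 1).toNat, (-q.1 + q.2).toNat)
  left_inv := by
    rintro ⟨x, y⟩
    dsimp only
    simp only [abs_le]
    split_ifs <;> simp only [Prod.mk.injEq] <;> omega
  right_inv := by
    rintro ⟨m, z⟩
    dsimp only
    simp only [abs_le]
    split_ifs <;> simp only [Prod.mk.injEq] <;> omega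

lemma tri_add_tri (p : ℕ × ℕ) :
    ((tri p.1 + tri p.2 : ℕ) : ℤ) = (triPairEquiv p).1 ^ 2 + 2 * tri (triPairEquiv p).2 := by
  obtain ⟨⟨m, z⟩, rfl⟩ := triPairEquiv.symm.surjective p
  rw [Equiv.apply_symm_apply]
  have key (x y : ℕ)
      (h : (x : ℤ) * (x + 1) + y * (y + 1) = 2 * m ^ 2 + 2 * (z * (z + 1))) :
      ((tri x + tri y : ℕ) : ℤ) = m ^ 2 + 2 * tri z := by
    have h₁ := two_mul_tri_cast x
    have h₂ := two_mul_tri_cast y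
    have h₃ := two_mul_tri_cast z
    push_cast
    linarith
  apply key
  simp only [triPairEquiv, Equiv.coe_fn_symm_mk, abs_le]
  split_ifs <;> rw [Int.toNat_of_nonneg (by omega), Int.toNat_of_nonneg (by omega)] <;> ring

/-- The triples `(d, y, δ)` of odd integers with `d, δ > 0` and `y² + 4dδ = M`. -/
noncomputable def oddForms (M : ℤ) : Finset (ℤ × ℤ × ℤ) :=
  (Finset.Icc 0 M ×ˢ Finset.Icc (-M) M ×ˢ Finset.Icc 0 M).filter fun p =>
    0 < p.1 ∧ 0 < p.2.2 ∧ p.1 % 2 = 1 ∧ p.2.1 % 2 = 1 ∧ p.2.2 % 2 = 1 ∧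
      p.2.1 ^ 2 + 4 * p.1 * p.2.2 = M

lemma mem_oddForms {M d y e : ℤ} : (d, y, e) ∈ oddForms M ↔
    0 < d ∧ 0 < e ∧ d % 2 = 1 ∧ y % 2 = 1 ∧ e % 2 = 1 ∧ y ^ 2 + 4 * d * e = M := by
  simp only [oddForms, Finset.mem_filter, Finset.mem_product, Finset.mem_Icc,
    and_iff_right_iff_imp]
  rintro ⟨hd, he, -, -, -, h⟩
  have : 0 < d * e := mul_pos hd he
  refine ⟨⟨hd.le, by nlinarith [sq_nonneg y]⟩, ⟨by nlinarith, by nlinarith⟩, he.le,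
    by nlinarith [sq_nonneg y]⟩

/-- An involution on forms of given discriminant, in the style of Zagier. -/
def formInvol (p : ℤ × ℤ × ℤ) : ℤ × ℤ × ℤ :=
  if p.2.1 + p.1 < p.2.2 then (p.1, -p.2.1 - 2 * p.1, p.2.2 - p.2.1 - p.1)
  else (p.1 + p.2.1 - p.2.2, 2 * p.2.2 - p.2.1, p.2.2)

lemma sum_oddForms_alternating (M : ℤ) :
    ∑ p ∈ oddForms M, (p.1 + p.2.2) * (p.2.1 - p.2.2) * (p.2.1 + p.1) = 0 := by
  have hneg (p : ℤ × ℤ × ℤ) : (p.1 + p.2.2) * (p.2.1 - p.2.2) * (p.2.1 + p.1) +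
      ((formInvol p).1 + (formInvol p).2.2) * ((formInvol p).2.1 - (formInvol p).2.2) *
        ((formInvol p).2.1 + (formInvol p).1) = 0 := by
    unfold formInvol
    split_ifs <;> ring
  refine Finset.sum_involution (fun p _ => formInvol p) (fun p _ => hneg p) ?_ ?_ ?_
  · rintro p - h0 h
    have := hneg p
    rw [h] at this
    omega
  · rintro ⟨d, y, e⟩ h
    rw [mem_oddForms] at h
    obtain ⟨hd, he, hd', hy', he', h⟩ := h
    simp only [formInvol]
    split_ifs
    all_goals
      rw [mem_oddForms]
      refine ⟨by omega, by omega, by omega, by omega, by omega, ?_⟩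
      rw [← h]; ring
  · rintro ⟨d, y, e⟩ h
    rw [mem_oddForms] at h
    simp only [formInvol]
    split_ifs with h₁ h₂ h₂ <;> dsimp only at h₂ <;>
      simp only [Prod.mk.injEq, true_and, and_true] <;> omega

lemma sum_oddForms_neg (M : ℤ) (f : ℤ → ℤ → ℤ → ℤ) :
    ∑ p ∈ oddForms M, f p.1 (-p.2.1) p.2.2 = ∑ p ∈ oddForms M, f p.1 p.2.1 p.2.2 := by
  have hmem : ∀ p ∈ oddForms M, (p.1, -p.2.1, p.2.2) ∈ oddForms M := by
    rintro ⟨d, y, e⟩ h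
    rw [mem_oddForms] at h ⊢
    dsimp only
    rw [neg_sq]
    omega
  refine Finset.sum_bij' (fun p _ => (p.1, -p.2.1, p.2.2)) (fun p _ => (p.1, -p.2.1, p.2.2))
    hmem hmem ?_ ?_ ?_ <;> simp

lemma sum_oddForms_swap (M : ℤ) (f : ℤ → ℤ → ℤ → ℤ) :
    ∑ p ∈ oddForms M, f p.2.2 p.2.1 p.1 = ∑ p ∈ oddForms M, f p.1 p.2.1 p.2.2 := by
  have hmem : ∀ p ∈ oddForms M, (p.2.2, p.2.1, p.1) ∈ oddForms M := by
    rintro ⟨d, y, e⟩ h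
    rw [mem_oddForms] at h ⊢
    obtain ⟨hd, he, hd', hy', he', h⟩ := h
    exact ⟨he, hd, he', hy', hd', by rw [← h]; ring⟩
  refine Finset.sum_bij' (fun p _ => (p.2.2, p.2.1, p.1)) (fun p _ => (p.2.2, p.2.1, p.1))
    hmem hmem ?_ ?_ ?_ <;> simp

lemma sum_oddForms (M : ℤ) :
    ∑ p ∈ oddForms M, p.1 * (p.2.1 ^ 2 - p.1 * p.2.2) = 0 := by
  have h₁ := sum_oddForms_alternating M
  have h₂ := sum_oddForms_neg M fun d y e => (d + e) * (y - e) * (y + d)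
  have h₃ := sum_oddForms_swap M fun d y e => d * (y ^ 2 - d * e)
  have h₄ : ∑ p ∈ oddForms M, (p.1 + p.2.2) * (p.2.1 - p.2.2) * (p.2.1 + p.1) +
      ∑ p ∈ oddForms M, (p.1 + p.2.2) * (-p.2.1 - p.2.2) * (-p.2.1 + p.1) =
      2 * ∑ p ∈ oddForms M, p.1 * (p.2.1 ^ 2 - p.1 * p.2.2) +
      2 * ∑ p ∈ oddForms M, p.2.2 * (p.2.1 ^ 2 - p.2.2 * p.1) := by
    simp only [Finset.mul_sum, ← Finset.sum_add_distrib]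
    exact Finset.sum_congr rfl fun p _ => by ring
  linarith

lemma sum_oddForms_pos (M : ℤ) :
    ∑ p ∈ oddForms M with 0 < p.2.1, p.1 * (p.2.1 ^ 2 - p.1 * p.2.2) = 0 := by
  have h := sum_oddForms M
  rw [← Finset.sum_filter_add_sum_filter_not _ (fun p => 0 < p.2.1)] at h
  have h₂ := sum_oddForms_neg M fun d y e => if 0 < y then d * (y ^ 2 - d * e) else 0
  rw [← Finset.sum_filter, ← Finset.sum_filter] at h₂
  have h₃ : (oddForms M).filter (fun p => 0 < -p.2.1) =
      (oddForms M).filter fun p => ¬ 0 < p.2.1 := by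
    refine Finset.filter_congr ?_
    rintro ⟨d, y, e⟩ hp
    rw [mem_oddForms] at hp
    dsimp only
    omega
  simp only [h₃, neg_sq] at h₂
  linarith

/-- The recurrence satisfied by `σ(2j+1)`. -/
lemma sum_sigma_recurrence (n : ℕ) :
    ∑ x ∈ Finset.range (n + 1) with tri x ≤ n, ((n : ℤ) - 5 * tri x) *
      ((∑ d ∈ (2 * (n - tri x) + 1).divisors, d : ℕ) : ℤ) = 0 := by
  have h := sum_oddForms_pos (8 * n + 5)
  have key : ∑ p ∈ oddForms (8 * n + 5) with 0 < p.2.1, p.1 * (p.2.1 ^ 2 - p.1 * p.2.2) =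
      ∑ x ∈ Finset.range (n + 1) with tri x ≤ n, ∑ d ∈ (2 * (n - tri x) + 1).divisors,
        (-2) * (((n : ℤ) - 5 * tri x) * d) := by
    rw [Finset.sum_sigma']
    symm
    refine Finset.sum_bij
      (fun q _ => ((q.2 : ℤ), 2 * (q.1 : ℤ) + 1, (((2 * (n - tri q.1) + 1) / q.2 : ℕ) : ℤ)))
      ?_ ?_ ?_ ?_
    · rintro ⟨x, d⟩ hq
      simp only [Finset.mem_sigma, Finset.mem_filter, Nat.mem_divisors] at hq
      obtain ⟨⟨-, hx⟩, ⟨e, he⟩, -⟩ := hq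
      have hd0 : 0 < d := Nat.pos_of_ne_zero (by rintro rfl; omega)
      have he0 : 0 < e := Nat.pos_of_ne_zero (by rintro rfl; omega)
      dsimp only
      rw [he, Nat.mul_div_cancel_left _ hd0]
      have hodd : Odd (d * e) := he ▸ odd_two_mul_add_one _
      obtain ⟨h₁, h₂⟩ := Nat.odd_mul.1 hodd
      rw [Nat.odd_iff] at h₁ h₂
      refine Finset.mem_filter.2 ⟨mem_oddForms.2
        ⟨by omega, by omega, by omega, by omega, by omega, ?_⟩, by dsimp only; omega⟩
      zify [hx] at he
      have := two_mul_tri_cast x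
      linear_combination -4 * this - 4 * he
    · rintro ⟨x, d⟩ - ⟨x', d'⟩ - heq
      simp only [Prod.mk.injEq] at heq
      obtain rfl : x = x' := by omega
      obtain rfl : d = d' := by omega
      rfl
    · rintro ⟨d, y, e⟩ hp
      rw [Finset.mem_filter, mem_oddForms] at hp
      obtain ⟨⟨hd, he, hd', hy', he', h⟩, hy⟩ := hp
      dsimp only at hy
      lift d to ℕ using hd.le
      lift e to ℕ using he.le
      obtain ⟨x, rfl⟩ : ∃ x : ℕ, y = 2 * x + 1 := ⟨(y / 2).toNat, by omega⟩
      have hT := two_mul_tri_cast x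
      have hde : 2 * ((n : ℤ) - tri x) + 1 = d * e := by linarith
      have hpos : (0 : ℤ) < d * e := mul_pos hd he
      have hle : tri x ≤ n := by omega
      have hde' : 2 * (n - tri x) + 1 = d * e := by zify [hle]; exact hde
      refine ⟨⟨x, d⟩, ?_, ?_⟩
      · simp only [Finset.mem_sigma, Finset.mem_filter, Finset.mem_range, Nat.mem_divisors]
        have := le_tri x
        exact ⟨⟨by omega, hle⟩, ⟨e, hde'⟩, by omega⟩
      · dsimp only
        rw [hde', Nat.mul_div_cancel_left _ (by omega)]
    · rintro ⟨x, d⟩ hq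
      simp only [Finset.mem_sigma, Finset.mem_filter, Nat.mem_divisors] at hq
      obtain ⟨⟨-, hx⟩, ⟨e, he⟩, -⟩ := hq
      have hd0 : 0 < d := Nat.pos_of_ne_zero (by rintro rfl; omega)
      dsimp only
      rw [he, Nat.mul_div_cancel_left _ hd0]
      zify [hx] at he
      have := two_mul_tri_cast x
      linear_combination 4 * (d : ℤ) * this - d * he
  rw [key] at h
  simp only [← Finset.mul_sum] at h
  push_cast
  linarith

/-- The `k`-tuples of natural numbers whose triangular numbers sum to `n`. -/
def triTuples (k n : ℕ) : Finset (Fin k → ℕ) :=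
  (Fintype.piFinset fun _ => Finset.range (n + 1)).filter fun x => ∑ i, tri (x i) = n

lemma mem_triTuples {k n : ℕ} {x : Fin k → ℕ} : x ∈ triTuples k n ↔ ∑ i, tri (x i) = n := by
  simp only [triTuples, Finset.mem_filter, Fintype.mem_piFinset, Finset.mem_range,
    and_iff_right_iff_imp]
  intro h i
  have := Finset.single_le_sum (f := fun i => tri (x i)) (fun _ _ => Nat.zero_le _)
    (Finset.mem_univ i)
  have := le_tri (x i)
  omega

lemma sum_triTuples_apply (k n : ℕ) (i : Fin (k + 1)) :
    ∑ x ∈ triTuples (k + 1) n, tri (x i) = ∑ x ∈ triTuples (k + 1) n, tri (x 0) := by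
  have hmem : ∀ x ∈ triTuples (k + 1) n, x ∘ Equiv.swap 0 i ∈ triTuples (k + 1) n := by
    intro x hx
    rw [mem_triTuples] at hx ⊢
    rw [← hx]
    exact Equiv.sum_comp (Equiv.swap 0 i) fun j => tri (x j)
  refine Finset.sum_bij' (fun x _ => x ∘ Equiv.swap 0 i) (fun x _ => x ∘ Equiv.swap 0 i)
    hmem hmem ?_ ?_ ?_
  · intro x _; funext j; simp
  · intro x _; funext j; simp
  · intro x _; simp

lemma sum_triTuples_succ (k n : ℕ) (w : ℕ → ℤ) :
    ∑ x ∈ triTuples (k + 1) n, w (x 0) =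
      ∑ x ∈ Finset.range (n + 1) with tri x ≤ n, w x * ((triTuples k (n - tri x)).card : ℤ) := by
  have h (x : ℕ) : w x * ((triTuples k (n - tri x)).card : ℤ) =
      ∑ _z ∈ triTuples k (n - tri x), w x := by
    rw [Finset.sum_const, nsmul_eq_mul, mul_comm]
  simp only [h]
  rw [Finset.sum_sigma']
  refine Finset.sum_bij' (fun x _ => ⟨x 0, Fin.tail x⟩) (fun q _ => Fin.cons q.1 q.2)
    ?_ ?_ ?_ ?_ ?_
  · intro x hx
    rw [mem_triTuples, Fin.sum_univ_succ] at hx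
    have := le_tri (x 0)
    simp only [Finset.mem_sigma, Finset.mem_filter, Finset.mem_range, mem_triTuples, Fin.tail]
    omega
  · rintro ⟨a, x⟩ hx
    simp only [Finset.mem_sigma, Finset.mem_filter, mem_triTuples] at hx
    simp only [mem_triTuples, Fin.sum_univ_succ, Fin.cons_zero, Fin.cons_succ]
    omega
  · intro x _; simp
  · intro q _; simp
  · intro x _; rfl

/-- The recurrence satisfied by the number of representations as a sum of four triangular
numbers. -/
lemma sum_card_recurrence (n : ℕ) :
    ∑ x ∈ Finset.range (n + 1) with tri x ≤ n, ((n : ℤ) - 5 * tri x) *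
      ((triTuples 4 (n - tri x)).card : ℤ) = 0 := by
  rw [← sum_triTuples_succ 4 n fun x => (n : ℤ) - 5 * tri x]
  have h : ∑ x ∈ triTuples 5 n, n = 5 * ∑ x ∈ triTuples 5 n, tri (x 0) := by
    calc ∑ x ∈ triTuples 5 n, n = ∑ x ∈ triTuples 5 n, ∑ i, tri (x i) :=
          Finset.sum_congr rfl fun x hx => (mem_triTuples.1 hx).symm
      _ = 5 * ∑ x ∈ triTuples 5 n, tri (x 0) := by
          rw [Finset.sum_comm, Finset.sum_congr rfl fun i _ => sum_triTuples_apply 4 n i]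
          simp
  rw [Finset.sum_sub_distrib, ← Finset.mul_sum, sub_eq_zero]
  exact_mod_cast h

/-- The recurrence determines a sequence from its value at `0`. -/
lemma eq_of_tri_recurrence {f g : ℕ → ℤ} (h0 : f 0 = g 0)
    (hf : ∀ n : ℕ, ∑ x ∈ Finset.range (n + 1) with tri x ≤ n,
      ((n : ℤ) - 5 * tri x) * f (n - tri x) = 0)
    (hg : ∀ n : ℕ, ∑ x ∈ Finset.range (n + 1) with tri x ≤ n,
      ((n : ℤ) - 5 * tri x) * g (n - tri x) = 0) (n : ℕ) : f n = g n := by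
  induction n using Nat.strong_induction_on with
  | _ n ih =>
    rcases Nat.eq_zero_or_pos n with rfl | hn
    · exact h0
    have hmem : 0 ∈ (Finset.range (n + 1)).filter fun x => tri x ≤ n := by
      simp [show tri 0 = 0 from rfl]
    have h₁ := hf n
    have h₂ := hg n
    rw [← Finset.add_sum_erase _ _ hmem] at h₁ h₂
    rw [Finset.sum_congr rfl (g := fun x => ((n : ℤ) - 5 * tri x) * g (n - tri x))] at h₁
    · have h₃ : (n : ℤ) * f n = n * g n := by
        simp only [show tri 0 = 0 from rfl, Nat.sub_zero, Nat.cast_zero, mul_zero,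
          sub_zero] at h₁ h₂
        linarith
      exact mul_left_cancel₀ (by omega) h₃
    · intro x hx
      rw [Finset.mem_erase, Finset.mem_filter] at hx
      have := le_tri x
      rw [ih (n - tri x) (by omega)]

/-- Legendre: the number of representations of `n` as a sum of four triangular numbers. -/
lemma card_triTuples_four (n : ℕ) :
    (triTuples 4 n).card = ∑ d ∈ (2 * n + 1).divisors, d := by
  have h := eq_of_tri_recurrence (f := fun n => ((triTuples 4 n).card : ℤ))
    (g := fun n => ((∑ d ∈ (2 * n + 1).divisors, d : ℕ) : ℤ)) (by decide)
    sum_card_recurrence sum_sigma_recurrence n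
  exact_mod_cast h

lemma deltaRep_one (k n : ℕ) : deltaRep k (fun _ => 1) n = (triTuples k n).card := by
  rw [deltaRep, ← Set.ncard_coe_finset]
  congr 1
  ext x
  simp [mem_triTuples, tri, eq_comm]

/-- Pairing up the coordinates of `8`-tuples and applying `triPairEquiv`. -/
def octupleEquiv : (Fin 8 → ℕ) ≃ (Fin 4 → ℤ) × (Fin 4 → ℕ) :=
  (((finProdFinEquiv (m := 4) (n := 2)).arrowCongr (Equiv.refl ℕ)).symm.trans
    (Equiv.curry (Fin 4) (Fin 2) ℕ)).trans
    ((Equiv.piCongrRight fun _ => finTwoArrowEquiv ℕ).trans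
      ((Equiv.piCongrRight fun _ => triPairEquiv).trans (Equiv.arrowProdEquivProdArrow _ _ _)))

lemma sum_tri_octuple (x : Fin 8 → ℕ) :
    ((∑ i, tri (x i) : ℕ) : ℤ) =
      ∑ i, (octupleEquiv x).1 i ^ 2 + 2 * ∑ i, (tri ((octupleEquiv x).2 i) : ℤ) := by
  rw [← Equiv.sum_comp (finProdFinEquiv (m := 4) (n := 2)), Fintype.sum_prod_type,
    Finset.mul_sum, ← Finset.sum_add_distrib, Nat.cast_sum]
  refine Finset.sum_congr rfl fun i _ => ?_
  rw [Fin.sum_univ_two]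
  exact tri_add_tri (x (finProdFinEquiv (m := 4) (n := 2) (i, 0)),
    x (finProdFinEquiv (m := 4) (n := 2) (i, 1)))

lemma finite_sum_sq (v a : ℕ) : {y : Fin v → ℤ | (a : ℤ) = ∑ i, y i ^ 2}.Finite := by
  refine (Set.Finite.pi' fun _ : Fin v => Set.finite_Icc (-(a : ℤ)) a).subset fun y hy i => ?_
  have h := Finset.single_le_sum (f := fun i => y i ^ 2) (fun _ _ => sq_nonneg _)
    (Finset.mem_univ i)
  rw [Set.mem_ofPred_eq] at hy
  rw [← hy] at h
  exact ⟨by nlinarith, by nlinarith⟩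

lemma rRep_one (v a : ℕ) : rRep v (fun _ => 1) a = (finite_sum_sq v a).toFinset.card := by
  rw [rRep, ← Set.ncard_eq_toFinset_card _ (finite_sum_sq v a)]
  simp

theorem delta_eight_formula (n : ℕ) :
    deltaRep 8 (fun _ => 1) n =
      ∑ p ∈ convPairs n, rRep 4 (fun _ => 1) p.1 * ∑ d ∈ (2 * p.2 + 1).divisors, d := by
  simp only [deltaRep_one, rRep_one, ← card_triTuples_four, ← Finset.card_product]
  rw [← Finset.card_sigma]
  refine Finset.card_bij'
    (fun x _ => ⟨(n - 2 * ∑ i, tri ((octupleEquiv x).2 i), ∑ i, tri ((octupleEquiv x).2 i)),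
      octupleEquiv x⟩) (fun q _ => octupleEquiv.symm q.2) ?_ ?_ ?_ ?_
  · intro x hx
    rw [mem_triTuples] at hx
    have h := sum_tri_octuple x
    have h0 : 0 ≤ ∑ i, (octupleEquiv x).1 i ^ 2 := Finset.sum_nonneg fun _ _ => sq_nonneg _
    rw [hx] at h
    simp only [← Nat.cast_sum] at h
    simp only [Finset.mem_sigma, convPairs, Finset.mem_filter, Finset.mem_product,
      Finset.mem_range, Set.Finite.mem_toFinset, Set.mem_ofPred_eq, mem_triTuples, and_true]
    omega
  · rintro ⟨⟨a, b⟩, y, z⟩ hq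
    simp only [Finset.mem_sigma, convPairs, Finset.mem_filter, Finset.mem_product,
      Finset.mem_range, Set.Finite.mem_toFinset, Set.mem_ofPred_eq, mem_triTuples] at hq
    have h := sum_tri_octuple (octupleEquiv.symm (y, z))
    simp only [Equiv.apply_symm_apply, ← Nat.cast_sum] at h
    rw [mem_triTuples]
    dsimp only
    omega
  · intro x _
    simp
  · rintro ⟨⟨a, b⟩, y, z⟩ hq
    simp only [Finset.mem_sigma, convPairs, Finset.mem_filter, Finset.mem_product,
      Finset.mem_range, Set.Finite.mem_toFinset, Set.mem_ofPred_eq, mem_triTuples] at hq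
    have ha : n - 2 * b = a := by omega
    simp [hq.2.2, ha]
end
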